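/- arXiv:2406.04905 — 3 statements merged into one kernel-verified Lean document; each statement's English description precedes it below -/
import Mathlib

section
/- Let μ < μ' be real numbers and let φ : ℝ → ℝ be twice continuously differentiable on (μ, μ'], with φ(t) > 0 for all t ∈ (μ, μ'] and φ(t) → 0 as t → μ⁺. Then liminf_{t→μ⁺} [φ''(t)/φ(t) − (φ'(t)/φ(t))²] = −∞; that is, for every M ∈ ℝ and every δ > 0 there exists t with μ < t < min(μ+δ, μ') such that φ''(t)/φ(t) − (φ'(t)/φ(t))² < M. -/
theorem liminf_log_second_deriv_eq_bot (μ μ' : ℝ) (hμ : μ < μ') (φ : ℝ → ℝ)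
    (hφ : ContDiffOn ℝ 2 φ (Set.Ioc μ μ'))
    (hpos : ∀ t ∈ Set.Ioc μ μ', 0 < φ t)
    (hlim : Filter.Tendsto φ (nhdsWithin μ (Set.Ioi μ)) (nhds 0)) :
    ∀ M : ℝ, ∀ δ > (0 : ℝ), ∃ t : ℝ, μ < t ∧ t < min (μ + δ) μ' ∧
      deriv (deriv φ) t / φ t - (deriv φ t / φ t) ^ 2 < M := by
  intro M δ hδ
  by_contra! hcon
  obtain ⟨b, hb⟩ : ∃ b, b = min (μ + δ) μ' := ⟨_, rfl⟩
  rw [← hb] at hcon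
  have hbμ : μ < b := by rw [hb]; exact lt_min (by linarith) hμ
  have hbμ' : b ≤ μ' := by rw [hb]; exact min_le_right _ _
  have hsub : Set.Ioo μ b ⊆ Set.Ioc μ μ' := fun t ht => ⟨ht.1, ht.2.le.trans hbμ'⟩
  have hC := hφ.mono hsub
  have hC1 : ContDiffOn ℝ 1 (deriv φ) (Set.Ioo μ b) :=
    hC.deriv_of_isOpen isOpen_Ioo (by norm_num)
  have hp : ∀ t ∈ Set.Ioo μ b, 0 < φ t := fun t ht => hpos t (hsub ht)
  have hd : ∀ t ∈ Set.Ioo μ b, HasDerivAt φ (deriv φ t) t := fun t ht =>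
    ((hC.differentiableOn (by norm_num)).differentiableAt
      (isOpen_Ioo.mem_nhds ht)).hasDerivAt
  have hd2 : ∀ t ∈ Set.Ioo μ b, HasDerivAt (deriv φ) (deriv (deriv φ) t) t := fun t ht =>
    ((hC1.differentiableOn (by norm_num)).differentiableAt
      (isOpen_Ioo.mem_nhds ht)).hasDerivAt
  have hg : ∀ t ∈ Set.Ioo μ b, HasDerivAt (fun s => deriv φ s / φ s - M * s)
      (deriv (deriv φ) t / φ t - (deriv φ t / φ t) ^ 2 - M) t := by
    intro t ht
    have h0 := (hp t ht).ne'
    have h := ((hd2 t ht).div (hd t ht) h0).sub ((hasDerivAt_id t).const_mul M)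
    refine h.congr_deriv ?_
    field_simp
    try ring
  have hmono : MonotoneOn (fun s => deriv φ s / φ s - M * s) (Set.Ioo μ b) := by
    apply monotoneOn_of_deriv_nonneg (convex_Ioo _ _)
    · exact fun t ht => (hg t ht).continuousAt.continuousWithinAt
    · rw [interior_Ioo]
      exact fun t ht => (hg t ht).differentiableAt.differentiableWithinAt
    · rw [interior_Ioo]
      intro t ht
      rw [(hg t ht).deriv]
      linarith [hcon t ht.1 ht.2]
  obtain ⟨c, hc1, hc2⟩ := exists_between hbμ
  obtain ⟨K, hK⟩ : ∃ K, K = deriv φ c / φ c + |M| * (c - μ) := ⟨_, rfl⟩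
  have hle : ∀ t ∈ Set.Ioc μ c, deriv φ t / φ t ≤ K := by
    intro t ht
    have h := hmono ⟨ht.1, ht.2.trans_lt hc2⟩ ⟨hc1, hc2⟩ ht.2
    simp only at h
    have h1 : (-M) * (c - t) ≤ |M| * (c - μ) :=
      mul_le_mul (neg_le_abs M) (by linarith [ht.1]) (by linarith [ht.2]) (abs_nonneg _)
    rw [hK]; linarith
  have hs : Set.Ioc μ c ⊆ Set.Ioo μ b := fun t ht => ⟨ht.1, ht.2.trans_lt hc2⟩
  have hf : ∀ t ∈ Set.Ioo μ b, HasDerivAt (fun s => Real.log (φ s) - K * s)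
      (deriv φ t / φ t - K) t := by
    intro t ht
    have h := ((hd t ht).log (hp t ht).ne').sub ((hasDerivAt_id t).const_mul K)
    refine h.congr_deriv ?_
    simp
  have hanti : AntitoneOn (fun s => Real.log (φ s) - K * s) (Set.Ioc μ c) := by
    apply antitoneOn_of_deriv_nonpos (convex_Ioc _ _)
    · exact fun t ht => (hf t (hs ht)).continuousAt.continuousWithinAt
    · exact fun t ht =>
        (hf t (hs (interior_subset ht))).differentiableAt.differentiableWithinAt
    · intro t ht
      rw [(hf t (hs (interior_subset ht))).deriv]
      linarith [hle t (interior_subset ht)]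
  obtain ⟨L, hL⟩ : ∃ L, L = Real.log (φ c) - |K| * (c - μ) := ⟨_, rfl⟩
  have hlow : ∀ t ∈ Set.Ioc μ c, Real.exp L ≤ φ t := by
    intro t ht
    rw [← Real.le_log_iff_exp_le (hp t (hs ht))]
    have h := hanti ht ⟨hc1, le_rfl⟩ ht.2
    simp only at h
    have h1 : K * (c - t) ≤ |K| * (c - μ) :=
      mul_le_mul (le_abs_self K) (by linarith [ht.1]) (by linarith [ht.2]) (abs_nonneg _)
    rw [hL]; linarith
  have hev : ∀ᶠ t in nhdsWithin μ (Set.Ioi μ), Real.exp L ≤ φ t := by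
    filter_upwards [Ioc_mem_nhdsGT hc1] with t ht using hlow t ht
  have := ge_of_tendsto hlim hev
  linarith [Real.exp_pos L]
end

section
/- Let μ < μ' be real numbers and let φ : ℝ → ℝ be twice continuously differentiable, with φ(t) = 0 for all t ≤ μ, and 0 < φ(t) < 1 for all t ∈ (μ, μ']. For τ ∈ (μ, μ'] set p(τ) := 1 − √(1 − φ(τ)) and D(τ) := φ(τ)·φ''(τ) − φ'(τ)² + ((φ(τ) − 2p(τ) + 2p(τ)²)/(1 − φ(τ)))·φ'(τ)² + p(τ)²·φ''(τ). Then liminf_{τ→μ⁺} D(τ)/φ(τ)² = −∞; in particular there exists τ ∈ (μ, μ') with D(τ) < 0. -/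
/-- The determinant quantity `D(τ) = det(B_{z₁} + C)` controlling the Levi form of
`W_η` with `η(t₂,t₃) = φ(t₂) + ψ(t₃)` at the boundary points with
`z₁ = (1 − √(1−φ))e^{iL}`, where `p = 1 − √(1−φ)`. -/
noncomputable def Dquant (φ : ℝ → ℝ) (τ : ℝ) : ℝ :=
  φ τ * deriv (deriv φ) τ - (deriv φ τ) ^ 2 +
    ((φ τ - 2 * (1 - Real.sqrt (1 - φ τ)) + 2 * (1 - Real.sqrt (1 - φ τ)) ^ 2) /
      (1 - φ τ)) * (deriv φ τ) ^ 2 +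
    (1 - Real.sqrt (1 - φ τ)) ^ 2 * deriv (deriv φ) τ

theorem Dquant_aux (φ : ℝ → ℝ) (t C : ℝ) (h0 : 0 < φ t) (h1 : φ t < 1) (hC : 0 ≤ C)
    (hg : (deriv φ t) ^ 2 / (1 - φ t) + deriv (deriv φ) t ≤ C) :
    Dquant φ t / (φ t) ^ 2 ≤
      (deriv (deriv φ) t * φ t - deriv φ t * deriv φ t) / (φ t) ^ 2 + C := by
  have hs0 : 0 < Real.sqrt (1 - φ t) := Real.sqrt_pos.2 (by linarith)
  have hs : Real.sqrt (1 - φ t) ^ 2 = 1 - φ t := Real.sq_sqrt (by linarith)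
  unfold Dquant
  set s := Real.sqrt (1 - φ t)
  have hs1 : s < 1 := by nlinarith
  have e : φ t - 2 * (1 - s) + 2 * (1 - s) ^ 2 = (1 - s) ^ 2 := by nlinarith
  have hp : (1 - s) ^ 2 ≤ (φ t) ^ 2 := by
    apply pow_le_pow_left₀ (by linarith)
    nlinarith
  rw [e]
  have hf : 0 < (φ t) ^ 2 := by positivity
  rw [div_add' _ _ _ hf.ne']
  apply div_le_div_of_nonneg_right _ hf.le
  have e2 : (1 - s) ^ 2 / (1 - φ t) * (deriv φ t) ^ 2 + (1 - s) ^ 2 * deriv (deriv φ) t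
      = (1 - s) ^ 2 * ((deriv φ t) ^ 2 / (1 - φ t) + deriv (deriv φ) t) := by ring
  have h3 := mul_le_mul_of_nonneg_left hg (sq_nonneg (1 - s))
  have h4 := mul_le_mul_of_nonneg_right hp hC
  linarith

theorem Dquant_main (μ μ' : ℝ) (hμ : μ < μ') (φ : ℝ → ℝ)
    (hφ : ContDiff ℝ 2 φ)
    (hzero : ∀ t ≤ μ, φ t = 0)
    (hpos : ∀ t ∈ Set.Ioc μ μ', 0 < φ t ∧ φ t < 1) (M δ : ℝ) (hδ : 0 < δ) :
    ∃ τ : ℝ, μ < τ ∧ τ < min (μ + δ) μ' ∧ Dquant φ τ / (φ τ) ^ 2 < M := by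
  by_contra! hcon
  obtain ⟨b, hb, hb'⟩ := exists_between (lt_min (by linarith : μ < μ + δ) hμ)
  have hbμ : b < μ' := hb'.trans_le (min_le_right _ _)
  have hd1 : ContDiff ℝ 1 (deriv φ) := ((contDiff_succ_iff_deriv (n := 1)).1 hφ).2.2
  have hd2 : Continuous (deriv (deriv φ)) := hd1.continuous_deriv le_rfl
  have hD : ∀ t, HasDerivAt φ (deriv φ t) t := fun t =>
    (hφ.differentiable (by norm_num) t).hasDerivAt
  have hDD : ∀ t, HasDerivAt (deriv φ) (deriv (deriv φ) t) t := fun t =>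
    (hd1.differentiable (by norm_num) t).hasDerivAt
  have hlt : ∀ t ∈ Set.Icc μ b, φ t < 1 := by
    intro t ht
    rcases ht.1.eq_or_lt with h | h
    · rw [hzero t h.symm.le]; norm_num
    · exact (hpos t ⟨h, ht.2.trans hbμ.le⟩).2
  have hgc : ContinuousOn (fun t => (deriv φ t) ^ 2 / (1 - φ t) + deriv (deriv φ) t)
      (Set.Icc μ b) := by
    refine ContinuousOn.add (ContinuousOn.div ?_ ?_ ?_) hd2.continuousOn
    · exact (hd1.continuous.pow 2).continuousOn
    · exact (continuous_const.sub hφ.continuous).continuousOn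
    · intro t ht; have := hlt t ht; linarith
  obtain ⟨C0, hC0⟩ := isCompact_Icc.bddAbove_image hgc
  obtain ⟨C, hC, hCC⟩ : ∃ C, 0 ≤ C ∧ C0 ≤ C := ⟨max 0 C0, le_max_left _ _, le_max_right _ _⟩
  have hp : ∀ t ∈ Set.Ioc μ b, 0 < φ t := fun t ht => (hpos t ⟨ht.1, ht.2.trans hbμ.le⟩).1
  have key : ∀ t ∈ Set.Ioo μ b,
      0 ≤ (deriv (deriv φ) t * φ t - deriv φ t * deriv φ t) / (φ t) ^ 2 + (C - M) := by
    intro t ht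
    have h1 := Dquant_aux φ t C (hp t ⟨ht.1, ht.2.le⟩) (hlt t ⟨ht.1.le, ht.2.le⟩) hC
      ((hC0 ⟨t, ⟨ht.1.le, ht.2.le⟩, rfl⟩).trans hCC)
    have h2 := hcon t ht.1 (ht.2.trans hb')
    linarith
  set K := C - M
  have hd : ∀ t ∈ Set.Ioc μ b, HasDerivAt (fun t => deriv φ t / φ t + K * t)
      ((deriv (deriv φ) t * φ t - deriv φ t * deriv φ t) / (φ t) ^ 2 + K) t := by
    intro t ht
    have := ((hDD t).div (hD t) (hp t ht).ne').add ((hasDerivAt_id t).const_mul K)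
    exact this.congr_deriv (by ring)
  have hmono : MonotoneOn (fun t => deriv φ t / φ t + K * t) (Set.Ioc μ b) := by
    apply monotoneOn_of_deriv_nonneg (convex_Ioc μ b)
    · exact fun t ht => (hd t ht).continuousAt.continuousWithinAt
    · rw [interior_Ioc]
      exact fun t ht => (hd t ⟨ht.1, ht.2.le⟩).differentiableAt.differentiableWithinAt
    · rw [interior_Ioc]
      intro t ht
      rw [(hd t ⟨ht.1, ht.2.le⟩).deriv]
      exact key t ht
  obtain ⟨A, hA⟩ : ∃ A, A = deriv φ b / φ b + K * b := ⟨_, rfl⟩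
  have hle : ∀ t ∈ Set.Ioc μ b, deriv φ t / φ t + K * t ≤ A := by
    intro t ht
    rw [hA]
    exact hmono ht ⟨hb, le_rfl⟩ ht.2
  have hd' : ∀ t ∈ Set.Ioc μ b, HasDerivAt (fun t => Real.log (φ t) + (K / 2 * t ^ 2 - A * t))
      (deriv φ t / φ t + (K * t - A)) t := by
    intro t ht
    have h1 := (hD t).log (hp t ht).ne'
    have h2 := ((hasDerivAt_id t).pow 2).const_mul (K / 2)
    have h3 := (hasDerivAt_id t).const_mul A
    refine (h1.add (h2.sub h3)).congr_deriv ?_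
    simp only [id]
    norm_num
    ring
  have hanti : AntitoneOn (fun t => Real.log (φ t) + (K / 2 * t ^ 2 - A * t))
      (Set.Ioc μ b) := by
    apply antitoneOn_of_deriv_nonpos (convex_Ioc μ b)
    · exact fun t ht => (hd' t ht).continuousAt.continuousWithinAt
    · rw [interior_Ioc]
      exact fun t ht => (hd' t ⟨ht.1, ht.2.le⟩).differentiableAt.differentiableWithinAt
    · rw [interior_Ioc]
      intro t ht
      rw [(hd' t ⟨ht.1, ht.2.le⟩).deriv]
      have := hle t ⟨ht.1, ht.2.le⟩
      linarith
  obtain ⟨c, hc⟩ : ∃ c, c = Real.log (φ b) + (K / 2 * b ^ 2 - A * b) := ⟨_, rfl⟩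
  have hexp : ∀ t ∈ Set.Ioc μ b, Real.exp (c - (K / 2 * t ^ 2 - A * t)) ≤ φ t := by
    intro t ht
    rw [← Real.le_log_iff_exp_le (hp t ht)]
    have := hanti ht ⟨hb, le_rfl⟩ ht.2
    simp only at this
    linarith
  have hfin : Real.exp (c - (K / 2 * μ ^ 2 - A * μ)) ≤ φ μ := by
    have hc1 : Continuous fun t => Real.exp (c - (K / 2 * t ^ 2 - A * t)) := by fun_prop
    refine le_of_tendsto_of_tendsto
      ((hc1.tendsto μ).mono_left (nhdsWithin_le_nhds (s := Set.Ioi μ)))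
      ((hφ.continuous.tendsto μ).mono_left nhdsWithin_le_nhds) ?_
    filter_upwards [Ioc_mem_nhdsGT hb] with t ht using hexp t ht
  rw [hzero μ le_rfl] at hfin
  exact absurd (Real.exp_pos _) (not_lt.2 hfin)

/-- If `φ` is `C²`, vanishes on `(-∞,μ]` and satisfies `0 < φ < 1` on `(μ,μ']`, then
`liminf_{τ→μ⁺} D(τ)/φ(τ)² = −∞`; in particular `D(τ) < 0` for some `τ ∈ (μ,μ')`. -/
theorem Dquant_liminf_eq_bot (μ μ' : ℝ) (hμ : μ < μ') (φ : ℝ → ℝ)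
    (hφ : ContDiff ℝ 2 φ)
    (hzero : ∀ t ≤ μ, φ t = 0)
    (hpos : ∀ t ∈ Set.Ioc μ μ', 0 < φ t ∧ φ t < 1) :
    (∀ M : ℝ, ∀ δ > (0 : ℝ), ∃ τ : ℝ, μ < τ ∧ τ < min (μ + δ) μ' ∧
        Dquant φ τ / (φ τ) ^ 2 < M) ∧
      ∃ τ : ℝ, μ < τ ∧ τ < μ' ∧ Dquant φ τ < 0 := by
  refine ⟨fun M δ hδ => Dquant_main μ μ' hμ φ hφ hzero hpos M δ hδ, ?_⟩
  obtain ⟨τ, h1, h2, h3⟩ := Dquant_main μ μ' hμ φ hφ hzero hpos 0 1 one_pos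
  refine ⟨τ, h1, h2.trans_le (min_le_right _ _), ?_⟩
  by_contra! h
  exact absurd h3 (not_lt.2 (div_nonneg h (sq_nonneg _)))
end

section
/- Let A > B > 0 and c > 0 be real numbers, and let g : ℝ² → ℝ be defined by g(t₂,t₃) := exp( c/(A² − B²) − c/(e^{t₂} + e^{t₃} − B²) ) if e^{t₂} + e^{t₃} > B², and g(t₂,t₃) := 0 otherwise. Then for every point (t₂,t₃) ∈ ℝ² with B² < e^{t₂} + e^{t₃} ≤ c, the real Hessian matrix of g at (t₂,t₃) (the 2×2 symmetric matrix of second partial derivatives) is positive semidefinite. -/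
/-- The building block `η₊` of the smooth worm construction. -/
noncomputable def etaPlus (A B c : ℝ) (t : ℝ × ℝ) : ℝ :=
  if B ^ 2 < Real.exp t.1 + Real.exp t.2 then
    Real.exp (c / (A ^ 2 - B ^ 2) - c / (Real.exp t.1 + Real.exp t.2 - B ^ 2))
  else 0

/-- Partial derivative in the first coordinate of `ℝ²`. -/
noncomputable def p2 (g : ℝ × ℝ → ℝ) (t : ℝ × ℝ) : ℝ :=
  deriv (fun x => g (x, t.2)) t.1

/-- Partial derivative in the second coordinate of `ℝ²`. -/
noncomputable def p3 (g : ℝ × ℝ → ℝ) (t : ℝ × ℝ) : ℝ :=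
  deriv (fun y => g (t.1, y)) t.2

/-- Smooth profile. -/
noncomputable def etaF (K B c s : ℝ) : ℝ := Real.exp (K - c / (s - B ^ 2))

lemma etaF_deriv (K B c s : ℝ) (h : B ^ 2 < s) :
    HasDerivAt (etaF K B c) (etaF K B c s * (c / (s - B ^ 2) ^ 2)) s := by
  have hu : s - B ^ 2 ≠ 0 := by linarith
  have h0 : HasDerivAt (fun s : ℝ => s - B ^ 2) 1 s := (hasDerivAt_id s).sub_const _
  have h3 := (((hasDerivAt_const s c).fun_div h0 hu).const_sub K).exp
  unfold etaF
  convert h3 using 1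
  ring

lemma etaF_deriv2 (K B c s : ℝ) (h : B ^ 2 < s) :
    HasDerivAt (fun s => etaF K B c s * (c / (s - B ^ 2) ^ 2))
      (etaF K B c s * (c / (s - B ^ 2) ^ 4) * (c - 2 * (s - B ^ 2))) s := by
  have hu : s - B ^ 2 ≠ 0 := by linarith
  have h0 : HasDerivAt (fun s : ℝ => s - B ^ 2) 1 s := (hasDerivAt_id s).sub_const _
  have h3 := (etaF_deriv K B c s h).fun_mul
    ((hasDerivAt_const s c).fun_div (h0.fun_pow 2) (pow_ne_zero 2 hu))
  refine h3.congr_deriv ?_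
  generalize etaF K B c s = F
  generalize s - B ^ 2 = u at *
  field_simp
  ring

lemma ev1 (B y x : ℝ) (h : B ^ 2 < Real.exp x + Real.exp y) :
    ∀ᶠ z in nhds x, B ^ 2 < Real.exp z + Real.exp y :=
  (Real.continuous_exp.add continuous_const).continuousAt.eventually (lt_mem_nhds h)

lemma ev2 (B y x : ℝ) (h : B ^ 2 < Real.exp x + Real.exp y) :
    ∀ᶠ z in nhds y, B ^ 2 < Real.exp x + Real.exp z :=
  (continuous_const.add Real.continuous_exp).continuousAt.eventually (lt_mem_nhds h)

lemma dx (x y : ℝ) : HasDerivAt (fun z => Real.exp z + Real.exp y) (Real.exp x) x :=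
  (Real.hasDerivAt_exp x).add_const _

lemma dy (x y : ℝ) : HasDerivAt (fun z => Real.exp x + Real.exp z) (Real.exp y) y :=
  (Real.hasDerivAt_exp y).const_add _

lemma eta_eq (A B c x y : ℝ) (h : B ^ 2 < Real.exp x + Real.exp y) :
    etaPlus A B c (x, y) = etaF (c / (A ^ 2 - B ^ 2)) B c (Real.exp x + Real.exp y) := by
  simp [etaPlus, etaF, h]

lemma p2_eta (A B c x y : ℝ) (h : B ^ 2 < Real.exp x + Real.exp y) :
    p2 (etaPlus A B c) (x, y) = etaF (c / (A ^ 2 - B ^ 2)) B c (Real.exp x + Real.exp y) *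
      (c / (Real.exp x + Real.exp y - B ^ 2) ^ 2) * Real.exp x := by
  unfold p2
  have e : (fun z => etaPlus A B c (z, y)) =ᶠ[nhds x]
      fun z => etaF (c / (A ^ 2 - B ^ 2)) B c (Real.exp z + Real.exp y) := by
    filter_upwards [ev1 B y x h] with z hz using eta_eq A B c z y hz
  rw [e.deriv_eq]
  exact (HasDerivAt.comp x (etaF_deriv (c / (A ^ 2 - B ^ 2)) B c _ h) (dx x y)).deriv

lemma p3_eta (A B c x y : ℝ) (h : B ^ 2 < Real.exp x + Real.exp y) :
    p3 (etaPlus A B c) (x, y) = etaF (c / (A ^ 2 - B ^ 2)) B c (Real.exp x + Real.exp y) *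
      (c / (Real.exp x + Real.exp y - B ^ 2) ^ 2) * Real.exp y := by
  unfold p3
  have e : (fun z => etaPlus A B c (x, z)) =ᶠ[nhds y]
      fun z => etaF (c / (A ^ 2 - B ^ 2)) B c (Real.exp x + Real.exp z) := by
    filter_upwards [ev2 B y x h] with z hz using eta_eq A B c x z hz
  rw [e.deriv_eq]
  exact (HasDerivAt.comp y (etaF_deriv (c / (A ^ 2 - B ^ 2)) B c _ h) (dy x y)).deriv

/-- Second derivative of the profile. -/
noncomputable def etaH (K B c s : ℝ) : ℝ :=
  etaF K B c s * (c / (s - B ^ 2) ^ 4) * (c - 2 * (s - B ^ 2))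

lemma p22 (A B c x y : ℝ) (h : B ^ 2 < Real.exp x + Real.exp y) :
    p2 (p2 (etaPlus A B c)) (x, y) =
      etaH (c / (A ^ 2 - B ^ 2)) B c (Real.exp x + Real.exp y) * Real.exp x * Real.exp x +
      etaF (c / (A ^ 2 - B ^ 2)) B c (Real.exp x + Real.exp y) *
      (c / (Real.exp x + Real.exp y - B ^ 2) ^ 2) * Real.exp x := by
  rw [p2]
  have e : (fun z => p2 (etaPlus A B c) (z, y)) =ᶠ[nhds x] fun z =>
      etaF (c / (A ^ 2 - B ^ 2)) B c (Real.exp z + Real.exp y) * (c / (Real.exp z + Real.exp y - B ^ 2) ^ 2) *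
        Real.exp z := by
    filter_upwards [ev1 B y x h] with z hz using p2_eta A B c z y hz
  rw [e.deriv_eq]
  exact ((HasDerivAt.comp x (etaF_deriv2 (c / (A ^ 2 - B ^ 2)) B c _ h) (dx x y)).fun_mul
    (Real.hasDerivAt_exp x)).deriv

lemma p33 (A B c x y : ℝ) (h : B ^ 2 < Real.exp x + Real.exp y) :
    p3 (p3 (etaPlus A B c)) (x, y) =
      etaH (c / (A ^ 2 - B ^ 2)) B c (Real.exp x + Real.exp y) * Real.exp y * Real.exp y +
      etaF (c / (A ^ 2 - B ^ 2)) B c (Real.exp x + Real.exp y) *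
      (c / (Real.exp x + Real.exp y - B ^ 2) ^ 2) * Real.exp y := by
  rw [p3]
  have e : (fun z => p3 (etaPlus A B c) (x, z)) =ᶠ[nhds y] fun z =>
      etaF (c / (A ^ 2 - B ^ 2)) B c (Real.exp x + Real.exp z) * (c / (Real.exp x + Real.exp z - B ^ 2) ^ 2) *
        Real.exp z := by
    filter_upwards [ev2 B y x h] with z hz using p3_eta A B c x z hz
  rw [e.deriv_eq]
  exact ((HasDerivAt.comp y (etaF_deriv2 (c / (A ^ 2 - B ^ 2)) B c _ h) (dy x y)).fun_mul
    (Real.hasDerivAt_exp y)).deriv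

lemma p23 (A B c x y : ℝ) (h : B ^ 2 < Real.exp x + Real.exp y) :
    p2 (p3 (etaPlus A B c)) (x, y) =
      etaH (c / (A ^ 2 - B ^ 2)) B c (Real.exp x + Real.exp y) * Real.exp x * Real.exp y := by
  rw [p2]
  have e : (fun z => p3 (etaPlus A B c) (z, y)) =ᶠ[nhds x] fun z =>
      etaF (c / (A ^ 2 - B ^ 2)) B c (Real.exp z + Real.exp y) * (c / (Real.exp z + Real.exp y - B ^ 2) ^ 2) *
        Real.exp y := by
    filter_upwards [ev1 B y x h] with z hz using p3_eta A B c z y hz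
  rw [e.deriv_eq]
  exact ((HasDerivAt.comp x (etaF_deriv2 (c / (A ^ 2 - B ^ 2)) B c _ h) (dx x y)).mul_const
    (Real.exp y)).deriv

lemma p32 (A B c x y : ℝ) (h : B ^ 2 < Real.exp x + Real.exp y) :
    p3 (p2 (etaPlus A B c)) (x, y) =
      etaH (c / (A ^ 2 - B ^ 2)) B c (Real.exp x + Real.exp y) * Real.exp y * Real.exp x := by
  rw [p3]
  have e : (fun z => p2 (etaPlus A B c) (x, z)) =ᶠ[nhds y] fun z =>
      etaF (c / (A ^ 2 - B ^ 2)) B c (Real.exp x + Real.exp z) * (c / (Real.exp x + Real.exp z - B ^ 2) ^ 2) *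
        Real.exp x := by
    filter_upwards [ev2 B y x h] with z hz using p2_eta A B c x z hz
  rw [e.deriv_eq]
  exact ((HasDerivAt.comp y (etaF_deriv2 (c / (A ^ 2 - B ^ 2)) B c _ h) (dy x y)).mul_const
    (Real.exp x)).deriv

lemma key_ineq (a b u c x y : ℝ) (ha : 0 < a) (hb : 0 < b) (hc : a + b ≤ c) :
    0 ≤ (c - 2 * u) * (a * x + b * y) ^ 2 + u ^ 2 * (a * x ^ 2 + b * y ^ 2) := by
  have hs : 0 < a + b := by positivity
  refine nonneg_of_mul_nonneg_right (a := a + b) ?_ hs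
  have : (a + b) * ((c - 2 * u) * (a * x + b * y) ^ 2 + u ^ 2 * (a * x ^ 2 + b * y ^ 2)) =
    ((c - (a + b)) * (a + b) + (a + b - u) ^ 2) * (a * x + b * y) ^ 2
      + u ^ 2 * (a * b) * (x - y) ^ 2 := by ring
  rw [this]
  have : 0 ≤ c - (a + b) := by linarith
  positivity

/-- At every point with `B² < e^{t₂} + e^{t₃} ≤ c`, the real Hessian matrix of `η₊`
is positive semidefinite. -/
theorem etaPlus_hessian_posSemidef (A B c : ℝ) (hAB : B < A) (hB : 0 < B) (hc : 0 < c)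
    (t : ℝ × ℝ) (h1 : B ^ 2 < Real.exp t.1 + Real.exp t.2)
    (h2 : Real.exp t.1 + Real.exp t.2 ≤ c) :
    Matrix.PosSemidef
      !![p2 (p2 (etaPlus A B c)) t, p2 (p3 (etaPlus A B c)) t;
         p3 (p2 (etaPlus A B c)) t, p3 (p3 (etaPlus A B c)) t] := by

  obtain ⟨x, y⟩ := t
  simp only at h1 h2
  rw [p22 A B c x y h1, p33 A B c x y h1, p23 A B c x y h1, p32 A B c x y h1]
  have hu : 0 < Real.exp x + Real.exp y - B ^ 2 := by linarith
  have hF : 0 < etaF (c / (A ^ 2 - B ^ 2)) B c (Real.exp x + Real.exp y) := Real.exp_pos _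
  unfold etaH
  generalize etaF (c / (A ^ 2 - B ^ 2)) B c (Real.exp x + Real.exp y) = F at *
  have ha := Real.exp_pos x
  have hb := Real.exp_pos y
  generalize Real.exp x = a at *
  generalize Real.exp y = b at *
  generalize a + b - B ^ 2 = u at *
  refine Matrix.PosSemidef.of_dotProduct_mulVec_nonneg ?_ ?_
  · ext i j
    fin_cases i <;> fin_cases j <;> simp <;> ring
  · intro v
    have key := key_ineq a b u c (v 0) (v 1) ha hb h2
    have h4 : 0 ≤ F * (c / u ^ 4) := by positivity
    have := mul_nonneg h4 key
    simp [dotProduct, Matrix.mulVec, Fin.sum_univ_two]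
    refine this.trans_eq ?_
    field_simp
    ring
end
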